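/- The refined Lassalle sequence is unimodal: for every k ≥ 0, the sequence (A_{k+1}(ℓ))_{1 ≤ ℓ ≤ 2k+1} satisfies A_{k+1}(1) ≤ A_{k+1}(2) ≤ ... ≤ A_{k+1}(k+1) ≥ ... ≥ A_{k+1}(2k+1). -/

import Mathlib

/-- Two blocks `B`, `B'` form a crossing: there are `i, k ∈ B` and `j, l ∈ B'`
with `i < j < k < l` or `i > j > k > l`. -/
def Crosses (B B' : Finset ℕ) : Prop :=
  ∃ i ∈ B, ∃ k ∈ B, ∃ j ∈ B', ∃ l ∈ B',
    (i < j ∧ j < k ∧ k < l) ∨ (i > j ∧ j > k ∧ k > l)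

/-- `ρ` is a set partition of `{0, ..., n-1}`. -/
def IsPartitionOf (n : ℕ) (ρ : Finset (Finset ℕ)) : Prop :=
  (∀ B ∈ ρ, B.Nonempty) ∧
  (∀ B ∈ ρ, ∀ B' ∈ ρ, B ≠ B' → Disjoint B B') ∧
  ρ.sup id = Finset.range n

/-- `r` is an orientation of the crossing graph `G(ρ)`: it relates exactly the
pairs of distinct crossing blocks of `ρ`, choosing one direction for each edge. -/
def IsOrientation (ρ : Finset (Finset ℕ)) (r : Finset ℕ → Finset ℕ → Prop) : Prop :=
  (∀ B B', r B B' → B ∈ ρ ∧ B' ∈ ρ ∧ B ≠ B' ∧ Crosses B B') ∧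
  (∀ B ∈ ρ, ∀ B' ∈ ρ, B ≠ B' → Crosses B B' → (r B B' ↔ ¬ r B' B))

/-- An orientation is acyclic if it has no directed cycle. -/
def AcyclicRel (r : Finset ℕ → Finset ℕ → Prop) : Prop :=
  ∀ B, ¬ Relation.TransGen r B B

/-- `r` is a root-connected orientation of `G(ρ)` with root `S`: it is an acyclic
orientation and `S` is its unique source. -/
def RootConnected (ρ : Finset (Finset ℕ)) (r : Finset ℕ → Finset ℕ → Prop)
    (S : Finset ℕ) : Prop :=
  IsOrientation ρ r ∧ AcyclicRel r ∧ S ∈ ρ ∧ (∀ B', ¬ r B' S) ∧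
    (∀ B ∈ ρ, (∀ B', ¬ r B' B) → B = S)

/-- `ρ ∈ M_S(n)`: a partition of `{0,...,n-1}` with `S` as a block and all
other blocks of size 2. -/
def MSPartition (n : ℕ) (S : Finset ℕ) (ρ : Finset (Finset ℕ)) : Prop :=
  IsPartitionOf n ρ ∧ S ∈ ρ ∧ ∀ B ∈ ρ, B ≠ S → B.card = 2

/-- The number of pairs `(ρ, r)` with `ρ ∈ M_S(n)` and `r` a root-connected
orientation of `G(ρ)` with root `S`.  (This is `A_{k+1}(S)` when `n = |S| + 2k`.) -/
noncomputable def countA (n : ℕ) (S : Finset ℕ) : ℕ :=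
  Nat.card {p : Finset (Finset ℕ) × (Finset ℕ → Finset ℕ → Prop) //
    MSPartition n S p.1 ∧ RootConnected p.1 p.2 S}

/-- `σ` is a perfect matching of `U`. -/
def IsMatching (U : Finset ℕ) (σ : Finset (Finset ℕ)) : Prop :=
  (∀ B ∈ σ, B.card = 2) ∧
  (∀ B ∈ σ, ∀ B' ∈ σ, B ≠ B' → Disjoint B B') ∧
  σ.sup id = U

/-- The block `B` has no incoming edge. -/
def IsSource (r : Finset ℕ → Finset ℕ → Prop) (B : Finset ℕ) : Prop :=
  ∀ C, ¬ r C B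

/-- Perfect matchings of `U` with an acyclic orientation of the crossing graph all of whose
sources satisfy `K`. -/
def sourcedMatchings (U : Finset ℕ) (K : Finset ℕ → Prop) :
    Set (Finset (Finset ℕ) × (Finset ℕ → Finset ℕ → Prop)) :=
  {p | IsMatching U p.1 ∧ IsOrientation p.1 p.2 ∧ AcyclicRel p.2 ∧
    ∀ B ∈ p.1, IsSource p.2 B → K B}

/-- The members of `sourcedMatchings` for the complement of `S`, with every source
crossing `S`. -/
noncomputable def rootedCount (n : ℕ) (S : Finset ℕ) : ℕ :=
  (sourcedMatchings (Finset.range n \ S) (Crosses S)).ncard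

theorem Crosses.symm {B B' : Finset ℕ} (h : Crosses B B') : Crosses B' B := by
  obtain ⟨i, hi, k, hk, j, hj, l, hl, h⟩ := h
  exact ⟨l, hl, j, hj, k, hk, i, hi, by omega⟩

theorem IsMatching.subset {U : Finset ℕ} {σ : Finset (Finset ℕ)} (h : IsMatching U σ)
    {B : Finset ℕ} (hB : B ∈ σ) : B ⊆ U := by
  rw [← h.2.2]
  exact Finset.le_sup (f := id) hB

theorem IsMatching.notMem {U : Finset ℕ} {σ : Finset (Finset ℕ)} (h : IsMatching U σ)
    {B : Finset ℕ} (hB : B.Nonempty) (hBU : Disjoint B U) : B ∉ σ := fun hmem =>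
  hB.ne_empty (Finset.disjoint_self_iff_empty _ |>.1 (hBU.mono_right (h.subset hmem)))

theorem isMatching_of_erase {U B : Finset ℕ} {σ : Finset (Finset ℕ)} (hBσ : B ∈ σ)
    (h : IsMatching (U \ B) (σ.erase B)) (hB : B.card = 2) (hBU : B ⊆ U) : IsMatching U σ := by
  have hdisj : ∀ C ∈ σ, C ≠ B → Disjoint C B := fun C hC hne =>
    Finset.sdiff_disjoint.mono_left (h.subset (Finset.mem_erase.2 ⟨hne, hC⟩))
  refine ⟨?_, ?_, ?_⟩
  · intro C hC
    by_cases hCB : C = B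
    · exact hCB ▸ hB
    · exact h.1 C (Finset.mem_erase.2 ⟨hCB, hC⟩)
  · intro C hC D hD hne
    by_cases hCB : C = B
    · exact hCB ▸ (hdisj D hD fun e => hne (hCB.trans e.symm)).symm
    · by_cases hDB : D = B
      · exact hDB ▸ hdisj C hC hCB
      · exact h.2.1 C (Finset.mem_erase.2 ⟨hCB, hC⟩) D (Finset.mem_erase.2 ⟨hDB, hD⟩) hne
  · rw [← Finset.insert_erase hBσ, Finset.sup_insert, h.2.2]
    exact Finset.union_sdiff_of_subset hBU

theorem IsMatching.erase {U B : Finset ℕ} {σ : Finset (Finset ℕ)} (h : IsMatching U σ)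
    (hB : B ∈ σ) : IsMatching (U \ B) (σ.erase B) := by
  refine ⟨fun C hC => h.1 C (Finset.mem_of_mem_erase hC), fun C hC D hD hne =>
    h.2.1 C (Finset.mem_of_mem_erase hC) D (Finset.mem_of_mem_erase hD) hne, ?_⟩
  ext x
  rw [← h.2.2]
  simp only [Finset.mem_sup, Finset.mem_erase, Finset.mem_sdiff, id]
  constructor
  · rintro ⟨C, ⟨hne, hC⟩, hx⟩
    exact ⟨⟨C, hC, hx⟩, fun hxB => Finset.disjoint_left.1 (h.2.1 C hC B hB hne) hx hxB⟩
  · rintro ⟨⟨C, hC, hx⟩, hxB⟩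
    exact ⟨C, ⟨fun e => hxB (e ▸ hx), hC⟩, hx⟩

theorem finite_sourcedMatchings (U : Finset ℕ) (K : Finset ℕ → Prop) :
    (sourcedMatchings U K).Finite := by
  classical
  have hfin : Set.Finite ((fun q : Finset (Finset ℕ) × Finset (Finset ℕ × Finset ℕ) =>
      (q.1, fun B B' => (B, B') ∈ q.2)) ''
      ((U.powerset.powerset ×ˢ (U.powerset ×ˢ U.powerset).powerset : Finset _) : Set _)) :=
    (Finset.finite_toSet _).image _
  refine hfin.subset ?_
  rintro ⟨ρ, r⟩ ⟨hM, hO, -, -⟩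
  have hsub : ∀ B ∈ ρ, B ∈ U.powerset := fun B hB => Finset.mem_powerset.2 (hM.subset hB)
  refine ⟨(ρ, (ρ ×ˢ ρ).filter fun q => r q.1 q.2), ?_, ?_⟩
  · simp only [Finset.coe_product, Set.mem_prod, Finset.mem_coe, Finset.mem_powerset]
    refine ⟨hsub, fun q hq => ?_⟩
    rw [Finset.mem_filter, Finset.mem_product] at hq
    exact Finset.mem_product.2 ⟨hsub _ hq.1.1, hsub _ hq.1.2⟩
  · ext B B'
    · rfl
    · simp only [Finset.mem_filter, Finset.mem_product]
      exact ⟨fun h => h.2, fun h => ⟨⟨(hO.1 B B' h).1, (hO.1 B B' h).2.1⟩, h⟩⟩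

theorem acyclicRel_add_source {B : Finset ℕ} {r r' : Finset ℕ → Finset ℕ → Prop}
    (hr : AcyclicRel r) (hsrc : IsSource r' B) (h : ∀ C D, C ≠ B → r' C D → r C D) :
    AcyclicRel r' := by
  have key : ∀ C D, C ≠ B → Relation.TransGen r' C D → D ≠ B ∧ Relation.TransGen r C D := by
    intro C D hC hCD
    induction hCD with
    | single hCD => exact ⟨fun e => hsrc _ (e ▸ hCD), .single (h _ _ hC hCD)⟩
    | tail _ hDE ih => exact ⟨fun e => hsrc _ (e ▸ hDE), ih.2.tail (h _ _ ih.1 hDE)⟩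
  intro C hC
  by_cases hCB : C = B
  · subst hCB
    cases hC with
    | single h1 => exact hsrc _ h1
    | tail _ h1 => exact hsrc _ h1
  · exact hr C (key C C hCB hC).2

/-- Deleting a block `B` that is a source: the new sources are blocks crossing `B`. -/
theorem ncard_source_eq {U B : Finset ℕ} (K : Finset ℕ → Prop) (hB : B.Nonempty)
    (hBU : Disjoint B U) :
    {p : Finset (Finset ℕ) × (Finset ℕ → Finset ℕ → Prop) |
      B ∈ p.1 ∧ IsMatching U (p.1.erase B) ∧ IsOrientation p.1 p.2 ∧ AcyclicRel p.2 ∧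
      IsSource p.2 B ∧ ∀ C ∈ p.1, C ≠ B → IsSource p.2 C → K C}.ncard =
    (sourcedMatchings U fun C => K C ∨ Crosses B C).ncard := by
  classical
  symm
  let f : Finset (Finset ℕ) × (Finset ℕ → Finset ℕ → Prop) →
      Finset (Finset ℕ) × (Finset ℕ → Finset ℕ → Prop) := fun p =>
    (insert B p.1, fun C D => p.2 C D ∨ (C = B ∧ D ∈ p.1 ∧ Crosses B D))
  have hinj : Set.InjOn f (sourcedMatchings U fun C => K C ∨ Crosses B C) := by
    rintro ⟨ρ, r⟩ ⟨hM, hO, -, -⟩ ⟨ρ', r'⟩ ⟨hM', hO', -, -⟩ he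
    have hn := hM.notMem hB hBU
    have hn' := hM'.notMem hB hBU
    simp only [f, Prod.mk.injEq] at he hn hn' ⊢
    obtain ⟨he1, he2⟩ := he
    refine ⟨by rw [← Finset.erase_insert hn, he1, Finset.erase_insert hn'], ?_⟩
    funext C D
    have h2 := congrFun (congrFun he2 C) D
    simp only [eq_iff_iff] at h2 ⊢
    constructor
    · intro h
      rcases h2.1 (Or.inl h) with h | h
      · exact h
      · exact absurd (h.1 ▸ (hO.1 _ _ ‹_›).1) hn
    · intro h
      rcases h2.2 (Or.inl h) with h | h
      · exact h
      · exact absurd (h.1 ▸ (hO'.1 _ _ ‹_›).1) hn'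
  rw [← hinj.ncard_image]
  congr 1
  ext ⟨ρ, r⟩
  constructor
  · rintro ⟨⟨σ, s⟩, ⟨hM, hO, hA, hS⟩, he⟩
    have hn := hM.notMem hB hBU
    simp only [f, Prod.mk.injEq] at he hn hM hO hA hS
    obtain ⟨rfl, rfl⟩ := he
    have hsrc : IsSource (fun C D => s C D ∨ (C = B ∧ D ∈ σ ∧ Crosses B D)) B := by
      rintro C (h | h)
      exacts [hn (hO.1 _ _ h).2.1, hn h.2.1]
    refine ⟨Finset.mem_insert_self _ _, by simpa [Finset.erase_insert hn] using hM, ⟨?_, ?_⟩,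
      acyclicRel_add_source hA hsrc ?_, hsrc, ?_⟩
    · rintro C D (h | ⟨rfl, h1, h2⟩)
      · obtain ⟨h1, h2, h3⟩ := hO.1 _ _ h
        exact ⟨Finset.mem_insert_of_mem h1, Finset.mem_insert_of_mem h2, h3⟩
      · exact ⟨Finset.mem_insert_self _ _, Finset.mem_insert_of_mem h1,
          fun e => hn (e ▸ h1), h2⟩
    · intro C hC D hD hne hcr
      rcases Finset.mem_insert.1 hC with rfl | hCσ <;>
        rcases Finset.mem_insert.1 hD with rfl | hDσ
      · exact absurd rfl hne
      · exact iff_of_true (Or.inr ⟨rfl, hDσ, hcr⟩) (hsrc _)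
      · exact iff_of_false (hsrc _) (not_not.2 (Or.inr ⟨rfl, hCσ, hcr.symm⟩))
      · have hCB : C ≠ B := fun e => hn (e ▸ hCσ)
        have hDB : D ≠ B := fun e => hn (e ▸ hDσ)
        simpa [hCB, hDB] using hO.2 C hCσ D hDσ hne hcr
    · rintro C D hC (h | h)
      exacts [h, absurd h.1 hC]
    · intro C hC hne hCs
      have hCσ : C ∈ σ := Finset.mem_of_mem_insert_of_ne hC hne
      rcases hS C hCσ fun D hD => hCs D (Or.inl hD) with h | h
      · exact h
      · exact absurd (Or.inr ⟨rfl, hCσ, h⟩) (hCs B)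
  · rintro ⟨hBρ, hM, hO, hA, hsrc, hS⟩
    simp only at hBρ hM hO hA hsrc hS
    refine ⟨(ρ.erase B, fun C D => r C D ∧ C ≠ B), ⟨hM, ⟨?_, ?_⟩, ?_, ?_⟩, ?_⟩
    · rintro C D ⟨h, hC⟩
      obtain ⟨h1, h2, h3⟩ := hO.1 _ _ h
      exact ⟨Finset.mem_erase.2 ⟨hC, h1⟩,
        Finset.mem_erase.2 ⟨fun e => hsrc C (e ▸ h), h2⟩, h3⟩
    · intro C hC D hD hne hcr
      obtain ⟨hC1, hC2⟩ := Finset.mem_erase.1 hC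
      obtain ⟨hD1, hD2⟩ := Finset.mem_erase.1 hD
      simpa [hC1, hD1] using hO.2 C hC2 D hD2 hne hcr
    · intro C hC
      exact hA C (Relation.TransGen.mono (fun _ _ h => h.1) _ _ hC)
    · intro C hC hCs
      obtain ⟨hC1, hC2⟩ := Finset.mem_erase.1 hC
      by_cases h : r B C
      · exact Or.inr (hO.1 _ _ h).2.2.2
      · exact Or.inl (hS C hC2 hC1 fun D hD => hCs D ⟨hD, fun e => h (e ▸ hD)⟩)
    · simp only [f, Prod.mk.injEq]
      refine ⟨Finset.insert_erase hBρ, ?_⟩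
      funext C D
      simp only [eq_iff_iff]
      constructor
      · rintro (h | ⟨rfl, hD, hcr⟩)
        · exact h.1
        · obtain ⟨hD1, hD2⟩ := Finset.mem_erase.1 hD
          exact (hO.2 _ hBρ _ hD2 (Ne.symm hD1) hcr).2 (hsrc _)
      · intro h
        by_cases hC : C = B
        · subst hC
          obtain ⟨h1, h2, h3, h4⟩ := hO.1 _ _ h
          exact Or.inr ⟨rfl, Finset.mem_erase.2 ⟨Ne.symm h3, h2⟩, h4⟩
        · exact Or.inl ⟨h, hC⟩

theorem mSPartition_iff {n : ℕ} {S : Finset ℕ} (hS : S.Nonempty) (hSn : S ⊆ Finset.range n)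
    (ρ : Finset (Finset ℕ)) :
    MSPartition n S ρ ↔ S ∈ ρ ∧ IsMatching (Finset.range n \ S) (ρ.erase S) := by
  constructor
  · rintro ⟨⟨h1, h2, h3⟩, hSρ, hc⟩
    refine ⟨hSρ, fun B hB => hc B (Finset.mem_of_mem_erase hB) (Finset.ne_of_mem_erase hB),
      fun C hC D hD hne =>
        h2 C (Finset.mem_of_mem_erase hC) D (Finset.mem_of_mem_erase hD) hne, ?_⟩
    ext x
    rw [← h3]
    simp only [Finset.mem_sup, Finset.mem_erase, Finset.mem_sdiff, id]
    constructor
    · rintro ⟨C, ⟨hne, hC⟩, hx⟩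
      exact ⟨⟨C, hC, hx⟩, fun hxB => Finset.disjoint_left.1 (h2 C hC S hSρ hne) hx hxB⟩
    · rintro ⟨⟨C, hC, hx⟩, hxB⟩
      exact ⟨C, ⟨fun e => hxB (e ▸ hx), hC⟩, hx⟩
  · rintro ⟨hSρ, hM⟩
    have hcard : ∀ B ∈ ρ, B ≠ S → B.card = 2 := fun B hB hne =>
      hM.1 B (Finset.mem_erase.2 ⟨hne, hB⟩)
    have hdisj : ∀ B ∈ ρ, B ≠ S → Disjoint B S := fun B hB hne =>
      Finset.sdiff_disjoint.mono_left (hM.subset (Finset.mem_erase.2 ⟨hne, hB⟩))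
    refine ⟨⟨?_, ?_, ?_⟩, hSρ, hcard⟩
    · intro B hB
      by_cases hne : B = S
      · exact hne ▸ hS
      · exact Finset.card_pos.1 (by rw [hcard B hB hne]; norm_num)
    · intro C hC D hD hne
      by_cases hCS : C = S
      · exact hCS ▸ (hdisj D hD fun e => hne (hCS.trans e.symm)).symm
      · by_cases hDS : D = S
        · exact hDS ▸ hdisj C hC hCS
        · exact hM.2.1 C (Finset.mem_erase.2 ⟨hCS, hC⟩) D (Finset.mem_erase.2 ⟨hDS, hD⟩) hne
    · rw [← Finset.insert_erase hSρ, Finset.sup_insert, hM.2.2]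
      exact Finset.union_sdiff_of_subset hSn

theorem countA_eq_rootedCount {n : ℕ} {S : Finset ℕ} (hS : S.Nonempty)
    (hSn : S ⊆ Finset.range n) : countA n S = rootedCount n S := by
  have h := ncard_source_eq (fun _ => False) hS
    (Finset.disjoint_sdiff : Disjoint S (Finset.range n \ S))
  simp only [false_or] at h
  rw [rootedCount, ← h, countA, ← Nat.card_coe_set_eq]
  refine Nat.card_congr (Equiv.subtypeEquivRight fun p => ?_)
  rw [mSPartition_iff hS hSn]
  simp only [Set.mem_ofPred_eq, RootConnected, IsSource]
  constructor
  · rintro ⟨⟨h1, h2⟩, h3, h4, -, h5, h6⟩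
    exact ⟨h1, h2, h3, h4, h5, fun C hC hne hs => hne (h6 C hC hs)⟩
  · rintro ⟨h1, h2, h3, h4, h5, h6⟩
    exact ⟨⟨h1, h2⟩, h3, h4, h1, h5, fun C hC hs => by_contra fun hne => h6 C hC hne hs⟩

theorem crosses_map_iff {e : Equiv.Perm ℕ} {U B B' : Finset ℕ}
    (he : StrictMonoOn e (U : Set ℕ)) (hB : B ⊆ U) (hB' : B' ⊆ U) :
    Crosses (B.map e.toEmbedding) (B'.map e.toEmbedding) ↔ Crosses B B' := by
  have hlt : ∀ x ∈ U, ∀ y ∈ U, e x < e y ↔ x < y := fun x hx y hy => he.lt_iff_lt hx hy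
  simp only [Crosses, Finset.mem_map, Equiv.coe_toEmbedding, exists_exists_and_eq_and, gt_iff_lt]
  refine exists_congr fun i => and_congr_right fun hi => exists_congr fun k =>
    and_congr_right fun hk => exists_congr fun j => and_congr_right fun hj =>
    exists_congr fun l => and_congr_right fun hl => ?_
  have hi := hB hi
  have hk := hB hk
  have hj := hB' hj
  have hl := hB' hl
  rw [hlt i hi j hj, hlt j hj k hk, hlt k hk l hl, hlt j hj i hi, hlt k hk j hj, hlt l hl k hk]

theorem ncard_sourcedMatchings_le_map {e : Equiv.Perm ℕ} {U : Finset ℕ}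
    (he : StrictMonoOn e (U : Set ℕ)) (K : Finset ℕ → Prop) :
    (sourcedMatchings U fun B => K (B.map e.toEmbedding)).ncard ≤
      (sourcedMatchings (U.map e.toEmbedding) K).ncard := by
  classical
  let φ : Finset ℕ ≃ Finset ℕ := e.finsetCongr
  have hφ : ∀ B, φ B = B.map e.toEmbedding := fun B => rfl
  refine Set.ncard_le_ncard_of_injOn (fun p => (p.1.map φ.toEmbedding,
    fun C D => p.2 (φ.symm C) (φ.symm D))) ?_ ?_ (finite_sourcedMatchings _ _)
  · rintro ⟨ρ, r⟩ ⟨hM, hO, hA, hS⟩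
    simp only at hM hO hA hS
    have hmem : ∀ B, B ∈ ρ.map φ.toEmbedding ↔ φ.symm B ∈ ρ := fun B => by
      rw [Finset.mem_map_equiv]
    have hcross : ∀ B ∈ ρ, ∀ B' ∈ ρ, (Crosses (φ B) (φ B') ↔ Crosses B B') :=
      fun B hB B' hB' => crosses_map_iff he (hM.subset hB) (hM.subset hB')
    refine ⟨⟨?_, ?_, ?_⟩, ⟨?_, ?_⟩, ?_, ?_⟩
    · intro B hB
      obtain ⟨C, hC, rfl⟩ := Finset.mem_map.1 hB
      exact (Finset.card_map _).trans (hM.1 C hC)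
    · intro B hB B' hB' hne
      obtain ⟨C, hC, rfl⟩ := Finset.mem_map.1 hB
      obtain ⟨C', hC', rfl⟩ := Finset.mem_map.1 hB'
      exact (Finset.disjoint_map _).2 (hM.2.1 C hC C' hC' fun e => hne (congrArg _ e))
    · ext x
      simp only [← hM.2.2, Finset.mem_sup, Finset.mem_map, id, Equiv.coe_toEmbedding]
      constructor
      · rintro ⟨_, ⟨C, hC, rfl⟩, hx⟩
        obtain ⟨y, hy, rfl⟩ := Finset.mem_map.1 hx
        exact ⟨y, ⟨C, hC, hy⟩, rfl⟩
      · rintro ⟨y, ⟨C, hC, hy⟩, rfl⟩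
        exact ⟨_, ⟨C, hC, rfl⟩, Finset.mem_map.2 ⟨y, hy, rfl⟩⟩
    · intro B B' h
      obtain ⟨h1, h2, h3, h4⟩ := hO.1 _ _ h
      refine ⟨(hmem B).2 h1, (hmem B').2 h2, fun e => h3 (congrArg _ e), ?_⟩
      simpa using (hcross _ h1 _ h2).2 h4
    · intro B hB B' hB' hne hcr
      have h1 := (hmem B).1 hB
      have h2 := (hmem B').1 hB'
      exact hO.2 _ h1 _ h2 (fun e => hne (φ.symm.injective e))
        ((hcross _ h1 _ h2).1 (by simpa using hcr))
    · intro B hB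
      exact hA _ (Relation.TransGen.lift φ.symm (fun _ _ h => h) _ _ hB)
    · intro B hB hs
      have := hS _ ((hmem B).1 hB) fun C hC => hs (φ C) (by simpa using hC)
      rwa [← hφ, Equiv.apply_symm_apply] at this
  · rintro ⟨ρ, r⟩ - ⟨ρ', r'⟩ - h
    simp only [Prod.mk.injEq] at h
    refine Prod.ext (Finset.map_injective _ h.1) ?_
    funext C D
    simpa using congrFun (congrFun h.2 (φ C)) (φ D)

/-- Relabelling the ground set by an order-preserving map. -/
theorem ncard_sourcedMatchings_map {e : Equiv.Perm ℕ} {U : Finset ℕ}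
    (he : StrictMonoOn e (U : Set ℕ)) (K : Finset ℕ → Prop) :
    (sourcedMatchings (U.map e.toEmbedding) K).ncard =
      (sourcedMatchings U fun B => K (B.map e.toEmbedding)).ncard := by
  refine le_antisymm ?_ (ncard_sourcedMatchings_le_map he K)
  have he' : StrictMonoOn e.symm (U.map e.toEmbedding : Set ℕ) := by
    intro a ha b hb hab
    simp only [Finset.coe_map, Equiv.coe_toEmbedding, Set.mem_image, Finset.mem_coe] at ha hb
    obtain ⟨a, ha, rfl⟩ := ha
    obtain ⟨b, hb, rfl⟩ := hb
    simpa using (he.lt_iff_lt ha hb).1 hab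
  have h := ncard_sourcedMatchings_le_map he' fun B => K (B.map e.toEmbedding)
  have hinv : ∀ B : Finset ℕ, (B.map e.symm.toEmbedding).map e.toEmbedding = B := fun B => by
    ext; simp
  have hinv' : (U.map e.toEmbedding).map e.symm.toEmbedding = U := by
    ext; simp
  simpa only [hinv, hinv'] using h

/-- Strengthening `K` to `K ∧ K'` when only the blocks `{m, q}` with `m ∈ T` are affected. -/
theorem ncard_sourcedMatchings_split {U T : Finset ℕ} {q : ℕ} (K K' : Finset ℕ → Prop)
    (hq : q ∈ U) (hT : T ⊆ U) (hqT : q ∉ T)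
    (h : ∀ B ⊆ U, B.card = 2 → (K B ∧ ¬ K' B ↔ ∃ m ∈ T, B = {m, q})) :
    (sourcedMatchings U K).ncard = (sourcedMatchings U fun B => K B ∧ K' B).ncard +
      ∑ m ∈ T, (sourcedMatchings (U \ {m, q}) fun C => K C ∨ Crosses {m, q} C).ncard := by
  classical
  let X : ℕ → Set (Finset (Finset ℕ) × (Finset ℕ → Finset ℕ → Prop)) := fun m =>
    {p | p ∈ sourcedMatchings U K ∧ {m, q} ∈ p.1 ∧ IsSource p.2 {m, q}}
  have hcard : ∀ m ∈ T, ({m, q} : Finset ℕ).card = 2 := fun m hm =>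
    Finset.card_pair fun e => hqT (e ▸ hm)
  have hsub : ∀ m ∈ T, ({m, q} : Finset ℕ) ⊆ U := fun m hm =>
    Finset.insert_subset (hT hm) (Finset.singleton_subset_iff.2 hq)
  have hK : ∀ m ∈ T, K {m, q} ∧ ¬ K' {m, q} := fun m hm =>
    (h _ (hsub m hm) (hcard m hm)).2 ⟨m, hm, rfl⟩
  have hfin : ∀ m, (X m).Finite := fun m =>
    (finite_sourcedMatchings U K).subset fun p hp => hp.1
  have hX : ∀ m ∈ T, (X m).ncard =
      (sourcedMatchings (U \ {m, q}) fun C => K C ∨ Crosses {m, q} C).ncard := by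
    intro m hm
    rw [← ncard_source_eq K (Finset.insert_nonempty _ _) Finset.disjoint_sdiff]
    congr 1
    ext ⟨ρ, r⟩
    constructor
    · rintro ⟨⟨hM, hO, hA, hS⟩, hB, hs⟩
      exact ⟨hB, hM.erase hB, hO, hA, hs, fun C hC _ => hS C hC⟩
    · rintro ⟨hB, hM, hO, hA, hs, hS⟩
      refine ⟨⟨isMatching_of_erase hB hM (hcard m hm) (hsub m hm), hO, hA, fun C hC hCs => ?_⟩,
        hB, hs⟩
      by_cases hne : C = {m, q}
      · exact hne ▸ (hK m hm).1
      · exact hS C hC hne hCs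
  have hunion : sourcedMatchings U K =
      (sourcedMatchings U fun B => K B ∧ K' B) ∪ ⋃ m ∈ (T : Set ℕ), X m := by
    ext ⟨ρ, r⟩
    constructor
    · rintro ⟨hM, hO, hA, hS⟩
      by_cases hall : ∀ B ∈ ρ, IsSource r B → K' B
      · exact Or.inl ⟨hM, hO, hA, fun B hB hs => ⟨hS B hB hs, hall B hB hs⟩⟩
      · push Not at hall
        obtain ⟨B, hB, hs, hK'⟩ := hall
        obtain ⟨m, hm, rfl⟩ := (h B (hM.subset hB) (hM.1 B hB)).1 ⟨hS B hB hs, hK'⟩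
        exact Or.inr (Set.mem_biUnion hm ⟨⟨hM, hO, hA, hS⟩, hB, hs⟩)
    · rintro (⟨hM, hO, hA, hS⟩ | hp)
      · exact ⟨hM, hO, hA, fun B hB hs => (hS B hB hs).1⟩
      · simp only [Set.mem_iUnion] at hp
        obtain ⟨m, hm, hp⟩ := hp
        exact hp.1
  have hdisj : Disjoint (sourcedMatchings U fun B => K B ∧ K' B) (⋃ m ∈ (T : Set ℕ), X m) := by
    rw [Set.disjoint_left]
    rintro ⟨ρ, r⟩ ⟨-, -, -, hS⟩ hp
    simp only [Set.mem_iUnion] at hp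
    obtain ⟨m, hm, -, hB, hs⟩ := hp
    exact (hK m hm).2 (hS _ hB hs).2
  have hpair : (T : Set ℕ).PairwiseDisjoint X := by
    intro m hm m' hm' hne
    rw [Function.onFun, Set.disjoint_left]
    rintro ⟨ρ, r⟩ ⟨⟨hM, -⟩, hB, -⟩ ⟨-, hB', -⟩
    have hne' : ({m, q} : Finset ℕ) ≠ {m', q} := by
      intro e
      have : m ∈ ({m', q} : Finset ℕ) := e ▸ Finset.mem_insert_self _ _
      rcases Finset.mem_insert.1 this with h | h
      · exact hne h
      · exact hqT ((Finset.mem_singleton.1 h : m = q) ▸ hm)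
    have hmm := Finset.disjoint_left.1 (hM.2.1 _ hB _ hB' hne')
    exact hmm (Finset.mem_insert_of_mem (Finset.mem_singleton_self q))
      (Finset.mem_insert_of_mem (Finset.mem_singleton_self q))
  have hfinU : (⋃ m ∈ (T : Set ℕ), X m).Finite :=
    T.finite_toSet.biUnion fun m _ => hfin m
  rw [hunion, Set.ncard_union_eq hdisj (finite_sourcedMatchings _ _) hfinU,
    T.finite_toSet.ncard_biUnion (fun m _ => hfin m) hpair, finsum_mem_coe_finset,
    Finset.sum_congr rfl hX]

theorem sourcedMatchings_congr {U : Finset ℕ} {K K' : Finset ℕ → Prop}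
    (h : ∀ B ⊆ U, B.card = 2 → (K B ↔ K' B)) : sourcedMatchings U K = sourcedMatchings U K' := by
  ext ⟨ρ, r⟩
  refine and_congr_right fun hM => and_congr_right fun _ => and_congr_right fun _ =>
    forall_congr' fun B => forall_congr' fun hB => ?_
  rw [h B (hM.subset hB) (hM.1 B hB)]

theorem crosses_pair_iff {S : Finset ℕ} (h0 : 0 ∈ S) {a b : ℕ} (hab : a < b) (ha : a ∉ S) :
    Crosses S {a, b} ↔ ∃ s ∈ S, a < s ∧ s < b := by
  have ha0 : 0 < a := Nat.pos_of_ne_zero fun e => ha (e ▸ h0)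
  constructor
  · rintro ⟨i, hi, k, hk, j, hj, l, hl, h⟩
    simp only [Finset.mem_insert, Finset.mem_singleton] at hj hl
    exact ⟨k, hk, by omega, by omega⟩
  · rintro ⟨s, hs, h1, h2⟩
    exact ⟨0, h0, s, hs, a, by simp, b, by simp, by omega⟩

theorem exists_lt_of_card_eq_two {B : Finset ℕ} (h : B.card = 2) :
    ∃ a b, a < b ∧ B = {a, b} := by
  obtain ⟨a, b, hne, rfl⟩ := Finset.card_eq_two.1 h
  rcases lt_or_gt_of_ne hne with h | h
  · exact ⟨a, b, h, rfl⟩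
  · exact ⟨b, a, h, Finset.pair_comm _ _⟩

/-- A chord crosses the enlarged block exactly when it crosses `S` or the added chord,
because the added chord has an endpoint next to a point of `S`. -/
theorem crosses_insert_insert_iff {S C : Finset ℕ} {p m : ℕ} (h0 : 0 ∈ S) (hp : p ∈ S)
    (hC : C.card = 2) (hCS : Disjoint C S) (hCm : Disjoint C {m, p + 1}) :
    Crosses (insert m (insert (p + 1) S)) C ↔ Crosses S C ∨ Crosses {m, p + 1} C := by
  obtain ⟨a, b, hab, rfl⟩ := exists_lt_of_card_eq_two hC
  simp only [Finset.disjoint_insert_left, Finset.disjoint_singleton_left, Finset.mem_insert,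
    Finset.mem_singleton, not_or] at hCS hCm
  obtain ⟨ha, hb⟩ := hCS
  obtain ⟨⟨ham, haq⟩, hbm, hbq⟩ := hCm
  have hap : a ≠ p := fun e => ha (e ▸ hp)
  have hbp : b ≠ p := fun e => hb (e ▸ hp)
  rw [crosses_pair_iff (by simp [h0]) hab (by simp [ha, ham, haq]), crosses_pair_iff h0 hab ha]
  constructor
  · rintro ⟨s, hs, h1, h2⟩
    rcases Finset.mem_insert.1 hs with rfl | hs
    · by_cases hq : a < p ∧ p < b
      · exact Or.inl ⟨p, hp, hq⟩
      · refine Or.inr ?_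
        by_cases hq' : p + 1 < a
        · exact ⟨p + 1, by simp, s, by simp, a, by simp, b, by simp, by omega⟩
        · exact ⟨p + 1, by simp, s, by simp, b, by simp, a, by simp, by omega⟩
    · rcases Finset.mem_insert.1 hs with rfl | hs
      · exact Or.inl ⟨p, hp, by omega, by omega⟩
      · exact Or.inl ⟨s, hs, h1, h2⟩
  · rintro (⟨s, hs, h⟩ | ⟨i, hi, k, hk, j, hj, l, hl, h⟩)
    · exact ⟨s, by simp [hs], h⟩
    · simp only [Finset.mem_insert, Finset.mem_singleton] at hi hk hj hl
      exact ⟨k, by rcases hk with rfl | rfl <;> simp, by omega, by omega⟩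

/-- Moving the point `p` of `S` to `p + 1`, where `x < p < y` are consecutive points of `S`
(or `y = n`). -/
theorem rootedCount_shift {n x p y : ℕ} {S : Finset ℕ} (h0 : 0 ∈ S) (hx : x ∈ S) (hxp : x < p)
    (hp : p ∈ S) (hpy : p + 1 < y) (hyn : y ≤ n) (hy : y ∈ S ∨ y = n)
    (hxS : ∀ m, x < m → m < p → m ∉ S) (hyS : ∀ m, p < m → m < y → m ∉ S) :
    rootedCount n (insert (p + 1) (S.erase p)) +
        ∑ m ∈ Finset.Ioo x p, rootedCount n (insert m (insert (p + 1) S)) =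
      rootedCount n S +
        ∑ m ∈ Finset.Ioo (p + 1) y, rootedCount n (insert m (insert (p + 1) S)) := by
  classical
  set S' := insert (p + 1) (S.erase p) with hS'
  set U := Finset.range n \ S with hU
  set τ : Equiv.Perm ℕ := Equiv.swap p (p + 1) with hτ
  have hmemU : ∀ m, m ∈ U ↔ m < n ∧ m ∉ S := fun m => by simp [hU]
  have hqS : p + 1 ∉ S := hyS _ (by omega) hpy
  have hqU : p + 1 ∈ U := (hmemU _).2 ⟨by omega, hqS⟩
  have hpU : p ∉ U := fun h => ((hmemU _).1 h).2 hp
  have h0' : 0 ∈ S' := by simp [hS', h0]; omega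
  have hτq : τ (p + 1) = p := Equiv.swap_apply_right _ _
  have hτp : τ p = p + 1 := Equiv.swap_apply_left _ _
  have hτm : ∀ m, m ≠ p → m ≠ p + 1 → τ m = m := fun m h1 h2 =>
    Equiv.swap_apply_of_ne_of_ne h1 h2
  have hneU : ∀ m ∈ U, m ≠ p := fun m hm e => hpU (e ▸ hm)
  have hmono : StrictMonoOn τ (U : Set ℕ) := by
    intro a ha b hb hab
    have ha' := hneU a ha
    have hb' := hneU b hb
    by_cases h1 : a = p + 1
    · rw [h1, hτq, hτm b hb' (by omega)]; omega
    · by_cases h2 : b = p + 1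
      · rw [h2, hτq, hτm a ha' h1]; omega
      · rwa [hτm a ha' h1, hτm b hb' h2]
  have hmap : U.map τ.toEmbedding = Finset.range n \ S' := by
    ext m
    rw [Finset.mem_map_equiv, hτ, Equiv.symm_swap, ← hτ, hmemU]
    simp only [Finset.mem_sdiff, Finset.mem_range, hS', Finset.mem_insert, Finset.mem_erase]
    by_cases h1 : m = p
    · subst h1; rw [hτp]; simp [hqS]; omega
    · by_cases h2 : m = p + 1
      · subst h2; rw [hτq]; simp [hp]
      · rw [hτm m h1 h2]; simp [h1, h2]
  set K : Finset ℕ → Prop := Crosses S with hK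
  set K' : Finset ℕ → Prop := fun B => Crosses S' (B.map τ.toEmbedding) with hK'
  have hpair : ∀ a b, K' {a, b} ↔ Crosses S' {τ a, τ b} := fun a b => by
    simp [hK', Finset.map_insert]
  have hcount : rootedCount n S' = (sourcedMatchings U K').ncard := by
    rw [rootedCount, ← hmap, ncard_sourcedMatchings_map hmono]
  have hsame : ∀ B ⊆ U, B.card = 2 → p + 1 ∉ B → (K' B ↔ K B) := by
    intro B hB hc hqB
    obtain ⟨a, b, hab, rfl⟩ := exists_lt_of_card_eq_two hc
    have ha : a ∈ U := hB (by simp)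
    have hb : b ∈ U := hB (by simp)
    simp only [Finset.mem_insert, Finset.mem_singleton, not_or] at hqB
    have hap := hneU a ha
    have hbp := hneU b hb
    have haS := ((hmemU a).1 ha).2
    rw [hK, hpair, hτm a hap (Ne.symm hqB.1), hτm b hbp (Ne.symm hqB.2),
      crosses_pair_iff h0' hab (by simp [hS', haS, Ne.symm hqB.1]), crosses_pair_iff h0 hab haS]
    constructor
    · rintro ⟨s, hs, h1, h2⟩
      rcases Finset.mem_insert.1 hs with rfl | hs
      · exact ⟨p, hp, by omega, by omega⟩
      · exact ⟨s, Finset.mem_of_mem_erase hs, h1, h2⟩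
    · rintro ⟨s, hs, h1, h2⟩
      by_cases hsp : s = p
      · exact ⟨p + 1, by simp [hS'], by omega, by omega⟩
      · exact ⟨s, by simp [hS', hs, hsp], h1, h2⟩
  have hKq : ∀ m ∈ U, m ≠ p + 1 → (K {m, p + 1} ↔ ¬ (p + 1 < m ∧ m < y)) := by
    intro m hm hmq
    have hmp := hneU m hm
    obtain ⟨hmn, hmS⟩ := (hmemU m).1 hm
    rcases lt_or_gt_of_ne hmq with hlt | hlt
    · exact iff_of_true ((crosses_pair_iff h0 hlt hmS).2 ⟨p, hp, by omega, by omega⟩) (by omega)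
    · rw [hK, Finset.pair_comm, crosses_pair_iff h0 hlt hqS]
      constructor
      · rintro ⟨s, hs, h1, h2⟩ h3
        exact hyS s (by omega) (by omega) hs
      · intro h
        rcases hy with hy | hy
        · have : m ≠ y := fun e => hmS (e ▸ hy)
          exact ⟨y, hy, by omega, by omega⟩
        · omega
  have hK'q : ∀ m ∈ U, m ≠ p + 1 → (K' {m, p + 1} ↔ ¬ (x < m ∧ m < p)) := by
    intro m hm hmq
    have hmp := hneU m hm
    obtain ⟨hmn, hmS⟩ := (hmemU m).1 hm
    rw [hpair, hτm m hmp hmq, hτq]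
    rcases lt_or_gt_of_ne hmp with hlt | hlt
    · rw [crosses_pair_iff h0' hlt (by simp [hS', hmS, hmq])]
      constructor
      · rintro ⟨s, hs, h1, h2⟩ h3
        rcases Finset.mem_insert.1 hs with rfl | hs
        · omega
        · exact hxS s (by omega) (by omega) (Finset.mem_of_mem_erase hs)
      · intro h
        have : m ≠ x := fun e => hmS (e ▸ hx)
        exact ⟨x, by simp [hS', hx]; omega, by omega, by omega⟩
    · refine iff_of_true ?_ (by omega)
      rw [Finset.pair_comm, crosses_pair_iff h0' hlt (by simp [hS'])]
      exact ⟨p + 1, by simp [hS'], by omega, by omega⟩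
  have hpairs : ∀ B ⊆ U, B.card = 2 → p + 1 ∈ B → ∃ m ∈ U, m ≠ p + 1 ∧ B = {m, p + 1} := by
    intro B hB hc hqB
    obtain ⟨a, b, hab, rfl⟩ := exists_lt_of_card_eq_two hc
    rcases Finset.mem_insert.1 hqB with h | h
    · exact ⟨b, hB (by simp), by omega, by rw [h, Finset.pair_comm]⟩
    · rw [Finset.mem_singleton] at h
      exact ⟨a, hB (by simp), by omega, by rw [h]⟩
  have hpair_inj : ∀ m m', m ≠ p + 1 → ({m, p + 1} : Finset ℕ) = {m', p + 1} → m = m' := by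
    intro m m' hm e
    have : m ∈ ({m', p + 1} : Finset ℕ) := e ▸ Finset.mem_insert_self _ _
    simpa [hm] using this
  have hT : ∀ m, x < m → m < y → m ≠ p → m ∈ U := fun m h1 h2 h3 => by
    refine (hmemU m).2 ⟨by omega, ?_⟩
    rcases lt_or_gt_of_ne h3 with h | h
    exacts [hxS m h1 h, hyS m h h2]
  have hdisjUS : ∀ C ⊆ U, Disjoint C S := fun C hC => Finset.sdiff_disjoint.mono_left hC
  have hsdiff : ∀ m, Finset.range n \ insert m (insert (p + 1) S) = U \ {m, p + 1} := fun m => by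
    ext a; simp [hU]; tauto
  have hterm : ∀ m, (sourcedMatchings (U \ {m, p + 1}) fun C => K C ∨ Crosses {m, p + 1} C).ncard
      = rootedCount n (insert m (insert (p + 1) S)) := by
    intro m
    rw [rootedCount, hsdiff]
    congr 1
    refine sourcedMatchings_congr fun C hC hc => ?_
    exact (crosses_insert_insert_iff h0 hp hc (hdisjUS C (hC.trans Finset.sdiff_subset))
      (Finset.sdiff_disjoint.mono_left hC)).symm
  have hterm' : ∀ m, (sourcedMatchings (U \ {m, p + 1}) fun C => K' C ∨ Crosses {m, p + 1} C).ncard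
      = rootedCount n (insert m (insert (p + 1) S)) := by
    intro m
    rw [← hterm]
    congr 1
    refine sourcedMatchings_congr fun C hC hc => ?_
    rw [hsame C (hC.trans Finset.sdiff_subset) hc fun h => by simpa using hC h]
  have e1 := ncard_sourcedMatchings_split (U := U) (T := Finset.Ioo x p) (q := p + 1) K K' hqU
    (fun m hm => by
      rw [Finset.mem_Ioo] at hm; exact hT m (by omega) (by omega) (by omega))
    (by simp) (by
      intro B hB hc
      by_cases hqB : p + 1 ∈ B
      · obtain ⟨m, hm, hmq, rfl⟩ := hpairs B hB hc hqB
        rw [hKq m hm hmq, hK'q m hm hmq]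
        constructor
        · exact fun h => ⟨m, by rw [Finset.mem_Ioo]; tauto, rfl⟩
        · rintro ⟨m', hm', e⟩
          rw [← hpair_inj m m' hmq e, Finset.mem_Ioo] at hm'
          omega
      · rw [hsame B hB hc hqB]
        refine iff_of_false (fun h => h.2 h.1) ?_
        rintro ⟨m, -, rfl⟩
        exact hqB (by simp))
  have e2 := ncard_sourcedMatchings_split (U := U) (T := Finset.Ioo (p + 1) y) (q := p + 1) K' K hqU
    (fun m hm => by
      rw [Finset.mem_Ioo] at hm; exact hT m (by omega) (by omega) (by omega))
    (by simp) (by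
      intro B hB hc
      by_cases hqB : p + 1 ∈ B
      · obtain ⟨m, hm, hmq, rfl⟩ := hpairs B hB hc hqB
        rw [hKq m hm hmq, hK'q m hm hmq]
        constructor
        · exact fun h => ⟨m, by rw [Finset.mem_Ioo]; tauto, rfl⟩
        · rintro ⟨m', hm', e⟩
          rw [← hpair_inj m m' hmq e, Finset.mem_Ioo] at hm'
          omega
      · rw [hsame B hB hc hqB]
        refine iff_of_false (fun h => h.2 h.1) ?_
        rintro ⟨m, -, rfl⟩
        exact hqB (by simp))
  simp only [hterm, hterm', and_comm] at e1 e2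
  have e0 : rootedCount n S = (sourcedMatchings U K).ncard := rfl
  have e3 : (sourcedMatchings U fun B => K B ∧ K' B) = sourcedMatchings U fun B => K' B ∧ K B := by
    simp only [and_comm]
  omega

/-- The partial sums `a, a + g₁, a + g₁ + g₂, …` of a list of gaps, without the last one. -/
def cuts : ℕ → List ℕ → Finset ℕ
  | _, [] => ∅
  | a, g :: l => insert a (cuts (a + g) l)

/-- `rootedCount` as a function of the list of gaps between consecutive points of the root. -/
noncomputable def gapCount (l : List ℕ) : ℕ :=
  rootedCount l.sum (cuts 0 l)

theorem cuts_append (a : ℕ) (l l' : List ℕ) :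
    cuts a (l ++ l') = cuts a l ∪ cuts (a + l.sum) l' := by
  induction l generalizing a with
  | nil => simp [cuts]
  | cons g l ih => simp [cuts, ih, Finset.insert_union, add_assoc]

theorem mem_cuts_bounds {a m : ℕ} {l : List ℕ} (hl : ∀ g ∈ l, 0 < g) (hm : m ∈ cuts a l) :
    a ≤ m ∧ m < a + l.sum := by
  induction l generalizing a with
  | nil => simp [cuts] at hm
  | cons g l ih =>
    have hg := hl g (by simp)
    rw [List.sum_cons]
    rcases Finset.mem_insert.1 hm with rfl | hm
    · omega
    · have := ih (fun g' hg' => hl g' (by simp [hg'])) hm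
      omega

theorem mem_cuts_self {a g : ℕ} {l : List ℕ} : a ∈ cuts a (g :: l) :=
  Finset.mem_insert_self _ _

theorem mem_cuts_zero_append {l l' : List ℕ} {g : ℕ} : 0 ∈ cuts 0 (l ++ g :: l') := by
  cases l <;> exact mem_cuts_self

theorem gapCount_shift {L R : List ℕ} (hL : ∀ g ∈ L, 0 < g) (hR : ∀ g ∈ R, 0 < g) {u v : ℕ}
    (hu : 0 < u) (hv : 0 < v) :
    gapCount (L ++ (u + 1) :: v :: R) +
        ∑ a ∈ Finset.Ioo 0 u, gapCount (L ++ a :: (u - a) :: 1 :: v :: R) =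
      gapCount (L ++ u :: (v + 1) :: R) +
        ∑ b ∈ Finset.Ioo 0 v, gapCount (L ++ u :: 1 :: b :: (v - b) :: R) := by
  set x := L.sum with hx
  set S := cuts 0 (L ++ u :: (v + 1) :: R) with hS
  have hSeq : S = cuts 0 L ∪ insert x (insert (x + u) (cuts (x + u + v + 1) R)) := by
    rw [hS, cuts_append, zero_add]
    simp only [cuts, ← hx]
    rw [← add_assoc]
  have hmem : ∀ m, m ∈ S ↔ m ∈ cuts 0 L ∨ m = x ∨ m = x + u ∨ m ∈ cuts (x + u + v + 1) R :=
    fun m => by simp only [hSeq, Finset.mem_union, Finset.mem_insert]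
  have hmL : ∀ m ∈ cuts 0 L, m < x := fun m hm => by
    have := mem_cuts_bounds hL hm
    omega
  have hmR : ∀ m ∈ cuts (x + u + v + 1) R, x + u + v + 1 ≤ m := fun m hm =>
    (mem_cuts_bounds hR hm).1
  have hn : (L ++ u :: (v + 1) :: R).sum = x + u + v + 1 + R.sum := by
    simp [← hx]; omega
  have key := rootedCount_shift (n := x + u + v + 1 + R.sum) (x := x) (p := x + u)
    (y := x + u + v + 1) (S := S) mem_cuts_zero_append ((hmem x).2 (by simp)) (by omega)
    ((hmem _).2 (by simp)) (by omega) (by omega)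
    (by
      cases R with
      | nil => right; simp
      | cons g R => exact Or.inl ((hmem _).2 (by simp [mem_cuts_self])))
    (fun m h1 h2 h => by
      rcases (hmem m).1 h with h | h | h | h
      · have := hmL m h; omega
      · omega
      · omega
      · have := hmR m h; omega)
    (fun m h1 h2 h => by
      rcases (hmem m).1 h with h | h | h | h
      · have := hmL m h; omega
      · omega
      · omega
      · have := hmR m h; omega)
  have e1 : gapCount (L ++ (u + 1) :: v :: R) =
      rootedCount (x + u + v + 1 + R.sum) (insert (x + u + 1) (S.erase (x + u))) := by
    have hsum : (L ++ (u + 1) :: v :: R).sum = x + u + v + 1 + R.sum := by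
      simp [← hx]; omega
    rw [gapCount, hsum]
    congr 1
    ext m
    rw [Finset.mem_insert, Finset.mem_erase, hmem, cuts_append, zero_add, ← hx]
    simp only [cuts, Finset.mem_union, Finset.mem_insert]
    rw [show x + (u + 1) + v = x + u + v + 1 by omega, ← add_assoc x u 1]
    have h1 := hmL m
    have h2 := hmR m
    constructor
    · rintro (h | h | h | h)
      · have := h1 h
        exact Or.inr ⟨by omega, Or.inl h⟩
      · exact Or.inr ⟨by omega, Or.inr (Or.inl h)⟩
      · exact Or.inl h
      · have := h2 h
        exact Or.inr ⟨by omega, by tauto⟩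
    · tauto
  have e2 : ∀ a ∈ Finset.Ioo 0 u, gapCount (L ++ a :: (u - a) :: 1 :: v :: R) =
      rootedCount (x + u + v + 1 + R.sum) (insert (x + a) (insert (x + u + 1) S)) := by
    intro a ha
    rw [Finset.mem_Ioo] at ha
    have hsum : (L ++ a :: (u - a) :: 1 :: v :: R).sum = x + u + v + 1 + R.sum := by
      simp [← hx]; omega
    rw [gapCount, hsum]
    congr 1
    ext m
    rw [Finset.mem_insert, Finset.mem_insert, hmem, cuts_append, zero_add, ← hx]
    simp only [cuts, Finset.mem_union, Finset.mem_insert]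
    rw [show x + a + (u - a) = x + u by omega, show x + u + 1 + v = x + u + v + 1 by omega]
    tauto
  have e3 : ∀ b ∈ Finset.Ioo 0 v, gapCount (L ++ u :: 1 :: b :: (v - b) :: R) =
      rootedCount (x + u + v + 1 + R.sum) (insert (x + u + 1 + b) (insert (x + u + 1) S)) := by
    intro b hb
    rw [Finset.mem_Ioo] at hb
    have hsum : (L ++ u :: 1 :: b :: (v - b) :: R).sum = x + u + v + 1 + R.sum := by
      simp [← hx]; omega
    rw [gapCount, hsum]
    congr 1
    ext m
    rw [Finset.mem_insert, Finset.mem_insert, hmem, cuts_append, zero_add, ← hx]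
    simp only [cuts, Finset.mem_union, Finset.mem_insert]
    rw [show x + u + 1 + b + (v - b) = x + u + v + 1 by omega]
    tauto
  have i1 : Finset.Ioo x (x + u) = (Finset.Ioo 0 u).map (addLeftEmbedding x) := by
    rw [Finset.map_add_left_Ioo, add_zero]
  have i2 : Finset.Ioo (x + u + 1) (x + u + v + 1) =
      (Finset.Ioo 0 v).map (addLeftEmbedding (x + u + 1)) := by
    rw [Finset.map_add_left_Ioo, add_zero, show x + u + 1 + v = x + u + v + 1 by omega]
  rw [i1, i2, Finset.sum_map, Finset.sum_map] at key
  rw [e1, Finset.sum_congr rfl e2, Finset.sum_congr rfl e3, gapCount, hn]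
  exact key

theorem symm_of_shift {H G : ℕ → ℕ → ℕ} {s : ℕ}
    (h : ∀ u v, 0 < u → 0 < v → u + v + 1 = s → H (u + 1) v + G v u = H u (v + 1) + G u v)
    {u v : ℕ} (hu : 0 < u) (hv : 0 < v) (huv : u + v = s) : H u v = H v u := by
  have key : ∀ u, 0 < u → ∀ v, 0 < v → u + v = s →
      (H u v : ℤ) - H v u = H 1 (s - 1) - H (s - 1) 1 := by
    intro u hu
    induction u, hu using Nat.le_induction with
    | base =>
      intro v hv huv
      rw [show s - 1 = v by omega]
    | succ u hu ih =>
      intro v hv huv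
      have h1 := h u v hu hv (by omega)
      have h2 := h v u hv hu (by omega)
      have h3 := ih (v + 1) (by omega) (by omega)
      omega
  have h1 := key u hu v hv huv
  have h2 := key v hv u hu (by omega)
  omega

theorem le_of_balanced {H : ℕ → ℕ → ℕ} {s : ℕ}
    (hsymm : ∀ u v, 0 < u → 0 < v → u + v = s → H u v = H v u)
    (hmono : ∀ u v, 0 < u → u ≤ v → u + v + 1 = s → H u (v + 1) ≤ H (u + 1) v)
    {u v w z : ℕ} (hu : 0 < u) (huw : u ≤ w) (huz : u ≤ z) (huv : u + v = s) (hwz : w + z = s) :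
    H u v ≤ H w z := by
  have key : ∀ w, u ≤ w → ∀ z, w ≤ z → w + z = s → H u v ≤ H w z := by
    intro w huw
    induction w, huw using Nat.le_induction with
    | base =>
      intro z _ hz
      rw [show z = v by omega]
    | succ w huw ih =>
      intro z hwz hz
      exact (ih (z + 1) (by omega) (by omega)).trans (hmono w z (by omega) (by omega) (by omega))
  rcases le_total w z with h | h
  · exact key w huw z h hwz
  · rw [hsymm w z (by omega) (by omega) hwz]
    exact key z huz w h (by omega)

theorem length_le_sum_of_pos {l : List ℕ} (hl : ∀ g ∈ l, 0 < g) : l.length ≤ l.sum := by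
  simpa using List.card_nsmul_le_sum l 1 hl

theorem gapCount_perm_and_mono (N : ℕ) :
    (∀ l l' : List ℕ, l.Perm l' → (∀ g ∈ l, 0 < g) → l.sum < l.length + N →
      gapCount l = gapCount l') ∧
    (∀ (u v : ℕ) (R : List ℕ), 0 < u → u ≤ v → (∀ g ∈ R, 0 < g) →
      u + v + 1 + R.sum < R.length + 2 + N →
      gapCount (u :: (v + 1) :: R) ≤ gapCount ((u + 1) :: v :: R)) := by
  induction N with
  | zero =>
    refine ⟨fun l l' _ hl h => ?_, fun u v R hu huv hR h => ?_⟩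
    · have := length_le_sum_of_pos hl
      omega
    · have := length_le_sum_of_pos hR
      omega
  | succ N ih =>
    obtain ⟨ihp, ihm⟩ := ih
    let G : List ℕ → List ℕ → ℕ → ℕ → ℕ := fun L R u v =>
      ∑ b ∈ Finset.Ioo 0 v, gapCount (L ++ u :: 1 :: b :: (v - b) :: R)
    have hpos : ∀ {L R : List ℕ} {a b c d : ℕ}, (∀ g ∈ L, 0 < g) → (∀ g ∈ R, 0 < g) →
        0 < a → 0 < b → 0 < c → 0 < d → ∀ g ∈ L ++ a :: b :: c :: d :: R, 0 < g := by
      intro L R a b c d hL hR ha hb hc hd g hg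
      simp only [List.mem_append, List.mem_cons] at hg
      rcases hg with h | rfl | rfl | rfl | rfl | h
      exacts [hL g h, ha, hb, hc, hd, hR g h]
    have hshift : ∀ L R : List ℕ, (∀ g ∈ L, 0 < g) → (∀ g ∈ R, 0 < g) → ∀ u v, 0 < u → 0 < v →
        L.sum + (u + v + 1) + R.sum < L.length + 2 + R.length + (N + 1) →
        gapCount (L ++ (u + 1) :: v :: R) + G L R v u =
          gapCount (L ++ u :: (v + 1) :: R) + G L R u v := by
      intro L R hL hR u v hu hv hlt
      rw [← gapCount_shift hL hR hu hv]
      congr 1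
      refine Finset.sum_congr rfl fun a ha => ?_
      rw [Finset.mem_Ioo] at ha
      refine ihp _ _ (List.Perm.append_left L ?_)
        (hpos hL hR hv one_pos ha.1 (by omega)) ?_
      · exact (List.perm_append_comm (l₁ := [v, 1]) (l₂ := [a, u - a])).append_right R |>.trans
          (((List.Perm.swap 1 v R).cons _).cons _)
      · simp only [List.sum_append, List.sum_cons, List.length_append, List.length_cons]
        omega
    have hswap : ∀ L R : List ℕ, (∀ g ∈ L, 0 < g) → (∀ g ∈ R, 0 < g) → ∀ u v, 0 < u → 0 < v →
        L.sum + (u + v) + R.sum < L.length + 2 + R.length + (N + 1) →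
        gapCount (L ++ u :: v :: R) = gapCount (L ++ v :: u :: R) := by
      intro L R hL hR u v hu hv hlt
      exact symm_of_shift (H := fun u v => gapCount (L ++ u :: v :: R)) (G := G L R) (s := u + v)
        (fun a b ha hb hab => hshift L R hL hR a b ha hb (by omega)) hu hv rfl
    have hperm : ∀ l l' : List ℕ, l.Perm l' → ∀ L : List ℕ, (∀ g ∈ L ++ l, 0 < g) →
        (L ++ l).sum < (L ++ l).length + (N + 1) → gapCount (L ++ l) = gapCount (L ++ l') := by
      intro l l' h
      induction h with
      | nil => intros; rfl
      | cons x h ih =>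
        intro L hL hlt
        simpa using ih (L ++ [x]) (by simpa using hL) (by simpa using hlt)
      | swap x y l =>
        intro L hL hlt
        simp only [List.sum_append, List.sum_cons, List.length_append, List.length_cons] at hlt
        exact hswap L l (fun g hg => hL g (by simp [hg])) (fun g hg => hL g (by simp [hg])) y x
          (hL y (by simp)) (hL x (by simp)) (by omega)
      | trans h1 h2 ih1 ih2 =>
        intro L hL hlt
        have hp := h1.append_left L
        rw [ih1 L hL hlt]
        exact ih2 L (fun g hg => hL g (hp.mem_iff.2 hg)) (by rwa [← hp.sum_eq, ← hp.length_eq])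
    refine ⟨fun l l' h hl hlt => hperm l l' h [] hl hlt, ?_⟩
    intro u v R hu huv hR hlt
    have hs := hshift [] R (by simp) hR u v hu (by omega) (by simp; omega)
    simp only [List.nil_append] at hs
    suffices G [] R v u ≤ G [] R u v by omega
    calc G [] R v u ≤ ∑ a ∈ Finset.Ioo 0 u, gapCount (u :: 1 :: a :: (v - a) :: R) := by
          refine Finset.sum_le_sum fun a ha => ?_
          rw [Finset.mem_Ioo] at ha
          have hR' : ∀ g ∈ 1 :: a :: R, 0 < g := by
            intro g hg
            simp only [List.mem_cons] at hg
            rcases hg with rfl | rfl | h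
            exacts [one_pos, ha.1, hR g h]
          have e1 : gapCount ([] ++ v :: 1 :: a :: (u - a) :: R) =
              gapCount ((u - a) :: v :: 1 :: a :: R) := by
            refine ihp _ _ ?_ (hpos (by simp) hR (by omega) one_pos ha.1 (by omega)) ?_
            · exact (List.perm_append_comm (l₁ := [v, 1, a]) (l₂ := [u - a])).append_right R
            · simp only [List.nil_append, List.sum_cons, List.length_cons]
              omega
          have e2 : gapCount (u :: 1 :: a :: (v - a) :: R) =
              gapCount (u :: (v - a) :: 1 :: a :: R) := by
            refine ihp _ _ ?_ (hpos (L := []) (by simp) hR hu one_pos ha.1 (by omega)) ?_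
            · exact ((List.perm_append_comm (l₁ := [1, a]) (l₂ := [v - a])).append_right R).cons u
            · simp only [List.sum_cons, List.length_cons]
              omega
          rw [e1, e2]
          refine le_of_balanced (H := fun b c => gapCount (b :: c :: 1 :: a :: R))
            (s := u + v - a) ?_ ?_ (by omega) (by omega) (by omega) (by omega) (by omega)
          · intro b c hb hc hbc
            refine ihp _ _ (List.Perm.swap _ _ _)
              (hpos (L := []) (by simp) hR hb hc one_pos ha.1) ?_
            simp only [List.sum_cons, List.length_cons]
            omega
          · intro b c hb hbc hsum
            refine ihm b c _ hb hbc hR' ?_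
            simp only [List.sum_cons, List.length_cons]
            omega
      _ ≤ G [] R u v :=
          Finset.sum_le_sum_of_subset (Finset.Ioo_subset_Ioo le_rfl huv)

theorem gapCount_pair_comm {u v : ℕ} (hu : 0 < u) (hv : 0 < v) :
    gapCount [u, v] = gapCount [v, u] :=
  (gapCount_perm_and_mono (u + v)).1 _ _ (List.Perm.swap _ _ _) (by simp [hu, hv])
    (by simp)

theorem gapCount_pair_mono {u v : ℕ} (hu : 0 < u) (huv : u ≤ v) :
    gapCount [u, v + 1] ≤ gapCount [u + 1, v] :=
  (gapCount_perm_and_mono (u + v)).2 u v [] hu huv (by simp) (by simp; omega)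

theorem countA_eq_gapCount {n l : ℕ} (hl : l < n) : countA n {0, l} = gapCount [l, n - l] := by
  rw [countA_eq_rootedCount (Finset.insert_nonempty _ _)]
  · simp [gapCount, cuts, Nat.add_sub_cancel' hl.le]
  · intro m hm
    simp only [Finset.mem_insert, Finset.mem_singleton] at hm
    exact Finset.mem_range.2 (by omega)

/-- Theorem (main): the refined Lassalle sequence
`A_{k+1}(ℓ) = countA (2k+2) {0, ℓ}` (counting root-connected orientations of
crossing graphs of perfect matchings of `{0,...,2k+1}` with root `{0, ℓ}`,
equivalently uniquely sorted permutations of length `2k+1` starting with `ℓ`)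
is unimodal: increasing for `1 ≤ ℓ ≤ k+1` and decreasing for `k+1 ≤ ℓ ≤ 2k+1`. -/
theorem refined_lassalle_unimodal (k : ℕ) :
    (∀ l : ℕ, 1 ≤ l → l ≤ k →
      countA (2 * k + 2) {0, l} ≤ countA (2 * k + 2) {0, l + 1}) ∧
    (∀ l : ℕ, k + 1 ≤ l → l ≤ 2 * k →
      countA (2 * k + 2) {0, l + 1} ≤ countA (2 * k + 2) {0, l}) := by
  refine ⟨fun l h1 h2 => ?_, fun l h1 h2 => ?_⟩
  · rw [countA_eq_gapCount (by omega), countA_eq_gapCount (by omega),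
      show 2 * k + 2 - l = 2 * k + 1 - l + 1 by omega,
      show 2 * k + 2 - (l + 1) = 2 * k + 1 - l by omega]
    exact gapCount_pair_mono (by omega) (by omega)
  · rw [countA_eq_gapCount (by omega), countA_eq_gapCount (by omega),
      gapCount_pair_comm (by omega) (by omega), gapCount_pair_comm (u := l) (by omega) (by omega),
      show 2 * k + 2 - l = 2 * k + 2 - (l + 1) + 1 by omega]
    exact gapCount_pair_mono (by omega) (by omega)
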